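/- arXiv:2411.08543 — 6 statements merged into one kernel-verified Lean document; each statement's English description precedes it below -/
import Mathlib

section
/- (Siegel's Lemma.) Let H₁ and H₂ be complex Hilbert spaces, let S be a unitary operator on H₁ ⊕ H₂ with block decomposition S = [[S₁₁, S₁₂],[S₂₁, S₂₂]], and let X be a unitary operator on H₂ such that 1 − X S₂₂ is boundedly invertible. Then the noncommutative Möbius transformation Möb(S, X) = S₁₁ + S₁₂ (1 − X S₂₂)⁻¹ X S₂₁ is a unitary operator on H₁. -/
open ContinuousLinearMap

/-- The second component of the adjoint of a block operator. -/
theorem adjoint_apply_snd_of_block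
    {H₁ H₂ : Type*}
    [NormedAddCommGroup H₁] [InnerProductSpace ℂ H₁] [CompleteSpace H₁]
    [NormedAddCommGroup H₂] [InnerProductSpace ℂ H₂] [CompleteSpace H₂]
    (S : WithLp 2 (H₁ × H₂) →L[ℂ] WithLp 2 (H₁ × H₂))
    (S₁₂ : H₂ →L[ℂ] H₁) (S₂₂ : H₂ →L[ℂ] H₂)
    (h₁ : ∀ w, (S (WithLp.toLp 2 (0, w))).fst = S₁₂ w)
    (h₂ : ∀ w, (S (WithLp.toLp 2 (0, w))).snd = S₂₂ w)
    (v : WithLp 2 (H₁ × H₂)) :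
    (adjoint S v).snd = adjoint S₁₂ v.fst + adjoint S₂₂ v.snd := by
  refine ext_inner_left ℂ fun w => ?_
  have h := adjoint_inner_right S (WithLp.toLp 2 (0, w)) v
  rw [WithLp.prod_inner_apply, WithLp.prod_inner_apply] at h
  change inner ℂ (0 : H₁) (adjoint S v).fst + inner ℂ w (adjoint S v).snd
    = inner ℂ (S (WithLp.toLp 2 (0, w))).fst v.fst
      + inner ℂ (S (WithLp.toLp 2 (0, w))).snd v.snd at h
  rw [h₁, h₂, inner_zero_left, zero_add] at h
  rw [h, inner_add_right, adjoint_inner_right, adjoint_inner_right]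

/-- A surjective linear isometry of a Hilbert space is unitary. -/
theorem mem_unitary_of_norm_map_of_surjective
    {H : Type*} [NormedAddCommGroup H] [InnerProductSpace ℂ H] [CompleteSpace H]
    (M : H →L[ℂ] H) (hnorm : ∀ u, ‖M u‖ = ‖u‖) (hsurj : Function.Surjective M) :
    M ∈ unitary (H →L[ℂ] H) := by
  have h := (norm_map_iff_adjoint_comp_self M).mp hnorm
  refine ⟨h, ?_⟩
  ext y
  obtain ⟨u, rfl⟩ := hsurj y
  exact congrArg M (DFunLike.congr_fun h u)

/-- Siegel's Lemma: the noncommutative Möbius transformation of a unitary block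
operator at a unitary feedback operator is unitary, whenever it is well posed. -/
theorem stmt_1
    {H₁ H₂ : Type*}
    [NormedAddCommGroup H₁] [InnerProductSpace ℂ H₁] [CompleteSpace H₁]
    [NormedAddCommGroup H₂] [InnerProductSpace ℂ H₂] [CompleteSpace H₂]
    (S : WithLp 2 (H₁ × H₂) →L[ℂ] WithLp 2 (H₁ × H₂))
    (hS : S ∈ unitary (WithLp 2 (H₁ × H₂) →L[ℂ] WithLp 2 (H₁ × H₂)))
    (S₁₁ : H₁ →L[ℂ] H₁) (S₁₂ : H₂ →L[ℂ] H₁)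
    (S₂₁ : H₁ →L[ℂ] H₂) (S₂₂ : H₂ →L[ℂ] H₂)
    (hblock : ∀ v : WithLp 2 (H₁ × H₂),
      (WithLp.equiv 2 (H₁ × H₂) (S v)).1
          = S₁₁ (WithLp.equiv 2 (H₁ × H₂) v).1 + S₁₂ (WithLp.equiv 2 (H₁ × H₂) v).2 ∧
      (WithLp.equiv 2 (H₁ × H₂) (S v)).2
          = S₂₁ (WithLp.equiv 2 (H₁ × H₂) v).1 + S₂₂ (WithLp.equiv 2 (H₁ × H₂) v).2)
    (X : H₂ →L[ℂ] H₂) (hX : X ∈ unitary (H₂ →L[ℂ] H₂))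
    (hinv : IsUnit (1 - X ∘L S₂₂)) :
    S₁₁ + S₁₂ ∘L Ring.inverse (1 - X ∘L S₂₂) ∘L (X ∘L S₂₁)
      ∈ unitary (H₁ →L[ℂ] H₁) := by
  set A : H₂ →L[ℂ] H₂ := 1 - X ∘L S₂₂ with hA
  have hfst (v : WithLp 2 (H₁ × H₂)) : (S v).fst = S₁₁ v.fst + S₁₂ v.snd := (hblock v).1
  have hsnd (v : WithLp 2 (H₁ × H₂)) : (S v).snd = S₂₁ v.fst + S₂₂ v.snd := (hblock v).2
  have hXnorm (w : H₂) : ‖X w‖ = ‖w‖ :=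
    (norm_map_iff_adjoint_comp_self X).mpr hX.1 w
  have hSnorm (v : WithLp 2 (H₁ × H₂)) : ‖S v‖ = ‖v‖ :=
    (norm_map_iff_adjoint_comp_self S).mpr hS.1 v
  have hAl (w : H₂) : Ring.inverse A (A w) = w :=
    DFunLike.congr_fun (Ring.inverse_mul_cancel A hinv) w
  have hAr (w : H₂) : A (Ring.inverse A w) = w :=
    DFunLike.congr_fun (Ring.mul_inverse_cancel A hinv) w
  apply mem_unitary_of_norm_map_of_surjective
  · intro u
    set w := Ring.inverse A (X (S₂₁ u))
    have hfix : w = X (S₂₁ u + S₂₂ w) := by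
      have h : A w = X (S₂₁ u) := hAr _
      rw [hA, sub_apply] at h
      rw [map_add, ← h]
      simp
    have h := congrArg (· ^ 2) (hSnorm (WithLp.toLp 2 (u, w)))
    simp only [WithLp.prod_norm_sq_eq_of_L2, hfst, hsnd] at h
    change ‖S₁₁ u + S₁₂ w‖ ^ 2 + ‖S₂₁ u + S₂₂ w‖ ^ 2 = ‖u‖ ^ 2 + ‖w‖ ^ 2 at h
    rw [← hXnorm (S₂₁ u + S₂₂ w), ← hfix] at h
    have h' : ‖S₁₁ u + S₁₂ w‖ ^ 2 = ‖u‖ ^ 2 := add_right_cancel h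
    exact (sq_eq_sq₀ (norm_nonneg _) (norm_nonneg _)).mp h'
  · intro y
    obtain ⟨t, ht⟩ : ∃ t, adjoint A t = adjoint S₁₂ y :=
      ⟨Ring.inverse (adjoint A) (adjoint S₁₂ y),
        DFunLike.congr_fun (Ring.mul_inverse_cancel _ hinv.star) _⟩
    set z := adjoint X t with hz
    have hXz : X z = t := DFunLike.congr_fun hX.2 t
    set v := adjoint S (WithLp.toLp 2 (y, z)) with hv
    have hSv : S v = WithLp.toLp 2 (y, z) := DFunLike.congr_fun hS.2 _
    have hvsnd : v.snd = X z := by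
      rw [hv, adjoint_apply_snd_of_block S S₁₂ S₂₂ (by simp [hfst]) (by simp [hsnd])]
      have hAt : adjoint A t = t - adjoint S₂₂ (adjoint X t) := by
        refine ext_inner_left ℂ fun w => ?_
        simp [hA, adjoint_inner_right, inner_sub_right]
      rw [hXz]
      change adjoint S₁₂ y + adjoint S₂₂ z = t
      rw [← ht, hAt, hz, sub_add_cancel]
    have hy : S₁₁ v.fst + S₁₂ v.snd = y := by rw [← hfst, hSv]; rfl
    have hz' : S₂₁ v.fst + S₂₂ v.snd = z := by rw [← hsnd, hSv]; rfl
    have hAv : A v.snd = X (S₂₁ v.fst) := by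
      rw [← hz', map_add] at hvsnd
      simpa [hA, sub_eq_iff_eq_add] using hvsnd
    refine ⟨v.fst, ?_⟩
    change S₁₁ v.fst + S₁₂ (Ring.inverse A (X (S₂₁ v.fst))) = y
    rw [← hAv, hAl, hy]
end

section
/- Let H₁ and H₂ be complex Hilbert spaces, let S be a bounded operator on H₁ ⊕ H₂ with block decomposition S = [[S₁₁, S₁₂],[S₂₁, S₂₂]] and ‖S‖ ≤ 1 (a contraction), and let X be a bounded operator on H₂ with ‖X‖ ≤ 1 such that 1 − X S₂₂ is boundedly invertible. Then the noncommutative Möbius transformation Möb(S, X) = S₁₁ + S₁₂ (1 − X S₂₂)⁻¹ X S₂₁ is a contraction on H₁, i.e. ‖Möb(S, X)‖ ≤ 1. -/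
open ContinuousLinearMap

/-- If the block operator `S` and the feedback operator `X` are contractions and the
loop is well posed, then the noncommutative Möbius transformation is a contraction. -/
theorem stmt_2
    {H₁ H₂ : Type*}
    [NormedAddCommGroup H₁] [InnerProductSpace ℂ H₁] [CompleteSpace H₁]
    [NormedAddCommGroup H₂] [InnerProductSpace ℂ H₂] [CompleteSpace H₂]
    (S : WithLp 2 (H₁ × H₂) →L[ℂ] WithLp 2 (H₁ × H₂))
    (hS : ‖S‖ ≤ 1)
    (S₁₁ : H₁ →L[ℂ] H₁) (S₁₂ : H₂ →L[ℂ] H₁)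
    (S₂₁ : H₁ →L[ℂ] H₂) (S₂₂ : H₂ →L[ℂ] H₂)
    (hblock : ∀ v : WithLp 2 (H₁ × H₂),
      (WithLp.equiv 2 (H₁ × H₂) (S v)).1
          = S₁₁ (WithLp.equiv 2 (H₁ × H₂) v).1 + S₁₂ (WithLp.equiv 2 (H₁ × H₂) v).2 ∧
      (WithLp.equiv 2 (H₁ × H₂) (S v)).2
          = S₂₁ (WithLp.equiv 2 (H₁ × H₂) v).1 + S₂₂ (WithLp.equiv 2 (H₁ × H₂) v).2)
    (X : H₂ →L[ℂ] H₂) (hX : ‖X‖ ≤ 1)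
    (hinv : IsUnit (1 - X ∘L S₂₂)) :
    ‖S₁₁ + S₁₂ ∘L Ring.inverse (1 - X ∘L S₂₂) ∘L (X ∘L S₂₁)‖ ≤ 1 := by
  refine opNorm_le_bound _ zero_le_one fun u => ?_
  set w : H₂ := Ring.inverse (1 - X ∘L S₂₂) (X (S₂₁ u))
  have hloop : w = X (S₂₁ u + S₂₂ w) := by
    have h : (1 - X ∘L S₂₂) w = X (S₂₁ u) :=
      DFunLike.congr_fun (Ring.mul_inverse_cancel _ hinv) (X (S₂₁ u))
    have h' : w - X (S₂₂ w) = X (S₂₁ u) := h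
    rw [map_add, ← h', sub_add_cancel]
  have hw_le : ‖w‖ ≤ ‖S₂₁ u + S₂₂ w‖ := by
    conv_lhs => rw [hloop]
    simpa using X.le_of_opNorm_le hX (S₂₁ u + S₂₂ w)
  obtain ⟨h₁, h₂⟩ := hblock (WithLp.toLp 2 (u, w))
  have hSv : ‖S (WithLp.toLp 2 (u, w))‖ ≤ ‖WithLp.toLp 2 (u, w)‖ := by
    simpa using S.le_of_opNorm_le hS (WithLp.toLp 2 (u, w))
  have hsq := pow_le_pow_left₀ (norm_nonneg _) hSv 2
  rw [WithLp.prod_norm_sq_eq_of_L2, WithLp.prod_norm_sq_eq_of_L2] at hsq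
  change (S (WithLp.toLp 2 (u, w))).fst = S₁₁ u + S₁₂ w at h₁
  change (S (WithLp.toLp 2 (u, w))).snd = S₂₁ u + S₂₂ w at h₂
  rw [h₁, h₂] at hsq
  change _ ≤ ‖u‖ ^ 2 + ‖w‖ ^ 2 at hsq
  have hw_sq := pow_le_pow_left₀ (norm_nonneg _) hw_le 2
  change ‖S₁₁ u + S₁₂ w‖ ≤ 1 * ‖u‖
  rw [one_mul]
  exact (sq_le_sq₀ (norm_nonneg _) (norm_nonneg _)).mp (by linarith)
end

section
/- (Sum-over-paths formula.) Let Sᴬ and Sᴮ be 2×2 complex matrices (with index 1 labelling the back channel and index 2 the external channel), let G₁, G₂, M ∈ ℂ, and set S := Sᴮ · diag(G₁, G₂) · Sᴬ. Define κ_I = Sᴮ₂₁ Sᴬ₁₂, κ_II = Sᴮ₂₂ Sᴬ₂₂, κ_III = Sᴮ₂₂ Sᴬ₂₁ Sᴮ₁₁ Sᴬ₁₂, κ_IV = Sᴮ₂₁ Sᴬ₁₁ Sᴮ₁₂ Sᴬ₂₂, κ_VII = Sᴮ₂₂ Sᴬ₂₁ Sᴮ₁₂ Sᴬ₂₂, κ_VIII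 = Sᴮ₂₁ Sᴬ₁₁ Sᴮ₁₁ Sᴬ₁₂, β_I = Sᴮ₁₁ Sᴬ₁₁, β_II = Sᴮ₁₂ Sᴬ₂₁. If 1 − S₁₁ M ≠ 0, then the feedback transfer coefficient S_fb = S₂₂ + S₂₁ M (1 − S₁₁ M)⁻¹ S₁₂ satisfies S_fb = κ_I G₁ + κ_II G₂ + ((κ_III + κ_IV) G₁ G₂ + κ_VII G₂² + κ_VIII G₁²) M / (1 − (β_I G₁ + β_II G₂) M). -/
/-- Sum-over-paths formula for the scalar two-beamsplitter time loop: the feedback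
transfer coefficient of `S = Sᴮ · diag(G₁, G₂) · Sᴬ` is expressed through the
feed-through coefficients `κ` and loop coefficients `β` of the eight classical paths.
(Matrix indices are 0-based: channel `0` is the back channel, channel `1` the
external channel, so e.g. `Sᴮ₂₁` is `SB 1 0`.) -/
theorem stmt_8
    (SA SB : Matrix (Fin 2) (Fin 2) ℂ) (G₁ G₂ M : ℂ)
    (S : Matrix (Fin 2) (Fin 2) ℂ)
    (hS : S = SB * Matrix.diagonal ![G₁, G₂] * SA)
    (κI κII κIII κIV κVII κVIII βI βII : ℂ)
    (hκI : κI = SB 1 0 * SA 0 1)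
    (hκII : κII = SB 1 1 * SA 1 1)
    (hκIII : κIII = SB 1 1 * SA 1 0 * SB 0 0 * SA 0 1)
    (hκIV : κIV = SB 1 0 * SA 0 0 * SB 0 1 * SA 1 1)
    (hκVII : κVII = SB 1 1 * SA 1 0 * SB 0 1 * SA 1 1)
    (hκVIII : κVIII = SB 1 0 * SA 0 0 * SB 0 0 * SA 0 1)
    (hβI : βI = SB 0 0 * SA 0 0)
    (hβII : βII = SB 0 1 * SA 1 0)
    (hwp : 1 - S 0 0 * M ≠ 0) :
    S 1 1 + S 1 0 * M * (1 - S 0 0 * M)⁻¹ * S 0 1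
      = κI * G₁ + κII * G₂
        + ((κIII + κIV) * G₁ * G₂ + κVII * G₂ ^ 2 + κVIII * G₁ ^ 2) * M
            / (1 - (βI * G₁ + βII * G₂) * M) := by
  have hS_apply (i j : Fin 2) : S i j = SB i 0 * G₁ * SA 0 j + SB i 1 * G₂ * SA 1 j := by
    simp [hS, Matrix.mul_apply, Fin.sum_univ_two]
  have hloop : (βI * G₁ + βII * G₂) * M = S 0 0 * M := by
    rw [hS_apply, hβI, hβII]
    ring
  rw [hloop, hS_apply 1 1, hS_apply 1 0, hS_apply 0 1, hκI, hκII, hκIII, hκIV, hκVII, hκVIII]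
  ring
end

section
/- (Greenberger–Svozil transfer coefficient.) Let R, T > 0 with R + T = 1, let Sᴬ = Sᴮ = [[√R, √T],[√T, −√R]], let G₁, G₂, M ∈ ℂ, and set S := Sᴮ · diag(G₁, G₂) · Sᴬ. If 1 − (R G₁ + T G₂) M ≠ 0, then the feedback transfer coefficient S_fb = S₂₂ + S₂₁ M (1 − S₁₁ M)⁻¹ S₁₂ equals T G₁ + R G₂ + R T (G₁ − G₂)² M / (1 − (R G₁ + T G₂) M). -/
/-- Greenberger–Svozil transfer coefficient: for identical beamsplitters
`Sᴬ = Sᴮ = [[√R, √T],[√T, −√R]]` with `R + T = 1`, the feedback transfer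
coefficient equals `T G₁ + R G₂ + R T (G₁ − G₂)² M / (1 − (R G₁ + T G₂) M)`.
(Indices are 0-based: channel `0` is the back channel, `1` the external one.) -/
theorem stmt_9
    (R T : ℝ) (hR : 0 < R) (hT : 0 < T) (hRT : R + T = 1)
    (G₁ G₂ M : ℂ)
    (SA SB S : Matrix (Fin 2) (Fin 2) ℂ)
    (hSA : SA = !![(Real.sqrt R : ℂ), (Real.sqrt T : ℂ);
                   (Real.sqrt T : ℂ), -(Real.sqrt R : ℂ)])
    (hSB : SB = SA)
    (hS : S = SB * Matrix.diagonal ![G₁, G₂] * SA)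
    (hwp : 1 - ((R : ℂ) * G₁ + (T : ℂ) * G₂) * M ≠ 0) :
    S 1 1 + S 1 0 * M * (1 - S 0 0 * M)⁻¹ * S 0 1
      = (T : ℂ) * G₁ + (R : ℂ) * G₂
        + (R : ℂ) * (T : ℂ) * (G₁ - G₂) ^ 2 * M
            / (1 - ((R : ℂ) * G₁ + (T : ℂ) * G₂) * M) := by
  have hr : (Real.sqrt R : ℂ) * (Real.sqrt R : ℂ) = R := by
    exact_mod_cast Real.mul_self_sqrt hR.le
  have ht : (Real.sqrt T : ℂ) * (Real.sqrt T : ℂ) = T := by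
    exact_mod_cast Real.mul_self_sqrt hT.le
  subst hSA hSB hS
  generalize (Real.sqrt R : ℂ) = r at *
  generalize (Real.sqrt T : ℂ) = t at *
  rw [← hr, ← ht]
  simp only [Matrix.mul_apply, Fin.sum_univ_two, Matrix.diagonal_apply, Matrix.of_apply,
    Matrix.cons_val', Matrix.cons_val_zero, Matrix.cons_val_one, Matrix.cons_val_fin_one,
    if_true, zero_ne_one, one_ne_zero, if_false, mul_zero, add_zero, zero_add]
  have hden : 1 - (r * G₁ * r + t * G₂ * t) * M = 1 - (r * r * G₁ + t * t * G₂) * M := by ring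
  rw [hden, div_eq_mul_inv]
  ring
end

section
/- (Amplitude reaching the in-loop detector.) Let H be a complex Hilbert space, let Sᴬᵢⱼ, Sᴮᵢⱼ (i, j ∈ {1,2}), G₂ and M be bounded operators on H with 1 − M Sᴮ₁₂ G₂ Sᴬ₂₁ boundedly invertible, and let ψ_in ∈ H. Then the system of equations ψ₂ = Sᴬ₂₁ ψ_back + Sᴬ₂₂ ψ_in, ψ_back = M Sᴮ₁₂ G₂ ψ₂, ψ₁ = Sᴬ₁₁ ψ_back + Sᴬ₁₂ ψ_in has a unique solution (ψ₁, ψ₂, ψ_back), and it satisfies ψ₁ = (Sᴬ₁₂ + Sᴬ₁₁ M (1 − Sᴮ₁₂ G₂ Sᴬ₂₁ M)⁻¹ Sᴮ₁₂ G₂ Sᴬ₂₂) ψ_in. -/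
open ContinuousLinearMap

/-- Jacobson's lemma: if `1 - a * b` is invertible, then so is `1 - b * a`. -/
theorem isUnit_one_sub_mul_swap {R : Type*} [Ring R] {a b : R}
    (h : IsUnit (1 - a * b)) : IsUnit (1 - b * a) := by
  obtain ⟨u, hu⟩ := h
  have hr : (1 - a * b) * (↑u⁻¹ : R) = 1 := by rw [← hu, Units.mul_inv]
  have hl : (↑u⁻¹ : R) * (1 - a * b) = 1 := by rw [← hu, Units.inv_mul]
  refine isUnit_iff_exists.mpr ⟨1 + b * ↑u⁻¹ * a, ?_, ?_⟩
  · calc (1 - b * a) * (1 + b * ↑u⁻¹ * a)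
        = 1 - b * a + b * ((1 - a * b) * ↑u⁻¹) * a := by noncomm_ring
      _ = 1 := by rw [hr]; noncomm_ring
  · calc (1 + b * ↑u⁻¹ * a) * (1 - b * a)
        = 1 - b * a + b * (↑u⁻¹ * (1 - a * b)) * a := by noncomm_ring
      _ = 1 := by rw [hl]; noncomm_ring

/-- If `1 - a * b` is invertible, then `a` intertwines the inverse of `1 - b * a`:
`(1 - a * b) * (a * (1 - b * a)⁻¹) = a`. -/
theorem one_sub_mul_mul_inverse_one_sub_mul_swap {R : Type*} [Ring R] {a b : R}
    (h : IsUnit (1 - a * b)) :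
    (1 - a * b) * (a * Ring.inverse (1 - b * a)) = a := by
  have hswap : IsUnit (1 - b * a) := isUnit_one_sub_mul_swap h
  have hcomm : (1 - a * b) * a = a * (1 - b * a) := by noncomm_ring
  rw [← mul_assoc, hcomm, mul_assoc, Ring.mul_inverse_cancel _ hswap, mul_one]

/-- Amplitude reaching the in-loop detector: the feedback system with a demolition
detector in branch 1 has a unique solution `(ψ₁, ψ₂, ψ_back)`, and the amplitude
entering branch 1 is `ψ₁ = (Sᴬ₁₂ + Sᴬ₁₁ M (1 − Sᴮ₁₂ G₂ Sᴬ₂₁ M)⁻¹ Sᴮ₁₂ G₂ Sᴬ₂₂) ψ_in`. -/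
theorem stmt_14
    {H : Type*} [NormedAddCommGroup H] [InnerProductSpace ℂ H] [CompleteSpace H]
    (SA₁₁ SA₁₂ SA₂₁ SA₂₂ SB₁₂ G₂ M : H →L[ℂ] H)
    (hinv : IsUnit (1 - M ∘L SB₁₂ ∘L G₂ ∘L SA₂₁))
    (ψin : H) :
    (∃! p : H × H × H,
        p.2.1 = SA₂₁ p.2.2 + SA₂₂ ψin ∧
        p.2.2 = (M ∘L SB₁₂ ∘L G₂) p.2.1 ∧
        p.1 = SA₁₁ p.2.2 + SA₁₂ ψin) ∧
      ∀ p : H × H × H,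
        (p.2.1 = SA₂₁ p.2.2 + SA₂₂ ψin ∧
         p.2.2 = (M ∘L SB₁₂ ∘L G₂) p.2.1 ∧
         p.1 = SA₁₁ p.2.2 + SA₁₂ ψin) →
        p.1 = (SA₁₂
          + SA₁₁ ∘L M ∘L Ring.inverse (1 - SB₁₂ ∘L G₂ ∘L SA₂₁ ∘L M)
              ∘L SB₁₂ ∘L G₂ ∘L SA₂₂) ψin := by
  set J := Ring.inverse (1 - SB₁₂ ∘L G₂ ∘L SA₂₁ ∘L M)
  have hop : (1 - M ∘L SB₁₂ ∘L G₂ ∘L SA₂₁) * (M * J) = M :=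
    one_sub_mul_mul_inverse_one_sub_mul_swap (a := M) (b := SB₁₂ ∘L G₂ ∘L SA₂₁) hinv
  have hM (x : H) : M (J x) - M (SB₁₂ (G₂ (SA₂₁ (M (J x))))) = M x := by
    simpa using DFunLike.congr_fun hop x
  have hinj : Function.Injective (1 - M ∘L SB₁₂ ∘L G₂ ∘L SA₂₁ : H →L[ℂ] H) := by
    obtain ⟨L, hL⟩ := hinv.exists_left_inv
    exact Function.LeftInverse.injective (g := L) fun x => DFunLike.congr_fun hL x
  set b := M (J (SB₁₂ (G₂ (SA₂₂ ψin))))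
  have hback (p : H × H × H) (h₂ : p.2.1 = SA₂₁ p.2.2 + SA₂₂ ψin)
      (hbk : p.2.2 = (M ∘L SB₁₂ ∘L G₂) p.2.1) : p.2.2 = b := by
    apply hinj
    have hfix : p.2.2 - M (SB₁₂ (G₂ (SA₂₁ p.2.2))) = M (SB₁₂ (G₂ (SA₂₂ ψin))) := by
      rw [h₂] at hbk
      simp only [comp_apply, map_add] at hbk
      exact sub_eq_of_eq_add' hbk
    simpa using hfix.trans (hM _).symm
  refine ⟨⟨(SA₁₁ b + SA₁₂ ψin, SA₂₁ b + SA₂₂ ψin, b), ⟨rfl, ?_, rfl⟩, ?_⟩, ?_⟩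
  · simp only [comp_apply, map_add]
    exact eq_add_of_sub_eq' (hM _)
  · rintro p ⟨h₂, hbk, h₁⟩
    have h := hback p h₂ hbk
    rw [h] at h₁ h₂
    exact Prod.ext h₁ (Prod.ext h₂ h)
  · rintro p ⟨h₂, hbk, h₁⟩
    rw [h₁, hback p h₂ hbk, add_comm]
    rfl
end

section
/- (The model matrix form is preserved under feedback reduction.) Fix n₁, n₂ ∈ ℕ. For a unitary (n₁+n₂)×(n₁+n₂) complex matrix S with blocks S₁₁ (n₁×n₁), S₁₂ (n₁×n₂), S₂₁ (n₂×n₁), S₂₂ (n₂×n₂), a vector β ∈ ℂ^{n₁+n₂} with components β₁ ∈ ℂ^{n₁}, β₂ ∈ ℂ^{n₂}, and θ ∈ ℝ, define the model matrix V(S, β, θ) as the (1+n₁+n₂)-square complex matrix with blocks [[−½ β*β − iθ, −β*S],[β, S]]. Let M be an n₁×n₁ unitary matrix such that 1 − S₁₁ M is invertible, and form the Möbius reduction of V(S, β, θ) that shorts the n₁ internal rows and columns through M, i.e. V_fb = V_EE + V_EI M (1 − V_II M)⁻¹ V_IE where the index set is partitioned into E = {scalar index} ∪ {external block of size n₂}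 and I = {internal block of size n₁} (so that V_II = S₁₁). Then there exists θ_fb ∈ ℝ such that V_fb = V(S_fb, β_fb, θ_fb), where S_fb = S₂₂ + S₂₁ M (1 − S₁₁ M)⁻¹ S₁₂ and β_fb = β₂ + S₂₁ M (1 − S₁₁ M)⁻¹ β₁. -/
open Matrix

/-- The model matrix `V(S, β, θ) = [[−½ β*β − iθ, −β*S],[β, S]]` of a linear device. -/
noncomputable def modelMatrix {m : Type*} [Fintype m]
    (S : Matrix m m ℂ) (β : m → ℂ) (θ : ℝ) :
    Matrix (Unit ⊕ m) (Unit ⊕ m) ℂ :=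
  Matrix.fromBlocks
    (Matrix.of fun _ _ => -(1 / 2 : ℂ) * (star β ⬝ᵥ β) - Complex.I * (θ : ℂ))
    (Matrix.of fun _ j => -(star β ᵥ* S) j)
    (Matrix.of fun i _ => β i)
    S

/-- Embedding of the external indices (the scalar index together with the `n₂`
external modes) into the index set of the model matrix. -/
def extIdx (n₁ n₂ : ℕ) : Unit ⊕ Fin n₂ → Unit ⊕ (Fin n₁ ⊕ Fin n₂) :=
  Sum.map id Sum.inr

/-- Embedding of the `n₁` internal indices into the index set of the model matrix. -/
def intIdx (n₁ n₂ : ℕ) : Fin n₁ → Unit ⊕ (Fin n₁ ⊕ Fin n₂) :=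
  fun i => Sum.inr (Sum.inl i)

namespace FeedbackReduction

variable {p q : Type*} [Fintype p] [Fintype q] [DecidableEq p] [DecidableEq q]

theorem conjTranspose_toBlocks_mul {S : Matrix (p ⊕ q) (p ⊕ q) ℂ}
    (hS : S ∈ unitaryGroup (p ⊕ q) ℂ) :
    S.toBlocks₁₁ᴴ * S.toBlocks₁₁ + S.toBlocks₂₁ᴴ * S.toBlocks₂₁ = 1 ∧
      S.toBlocks₁₁ᴴ * S.toBlocks₁₂ + S.toBlocks₂₁ᴴ * S.toBlocks₂₂ = 0 := by
  have h : Sᴴ * S = 1 := mem_unitaryGroup_iff'.mp hS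
  rw [← fromBlocks_toBlocks S, fromBlocks_conjTranspose, fromBlocks_multiply,
    ← fromBlocks_one, fromBlocks_inj] at h
  exact ⟨h.1, h.2.1⟩

theorem one_add_mul_inv {A M : Matrix p p ℂ} (h : IsUnit (1 - A * M)) :
    1 + A * (M * (1 - A * M)⁻¹) = (1 - A * M)⁻¹ := by
  have h' := mul_nonsing_inv _ ((isUnit_iff_isUnit_det _).mp h)
  rw [sub_mul, one_mul, sub_eq_iff_eq_add] at h'
  rw [← mul_assoc]
  exact h'.symm

theorem conjTranspose_mul_sub {A M : Matrix p p ℂ} (hM : M ∈ unitaryGroup p ℂ)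
    (h : IsUnit (1 - A * M)) :
    (M * (1 - A * M)⁻¹)ᴴ * (M - Aᴴ) = 1 := by
  have hMM : Mᴴ * M = 1 := mem_unitaryGroup_iff'.mp hM
  have h' := congrArg conjTranspose (mul_nonsing_inv _ ((isUnit_iff_isUnit_det _).mp h))
  rw [conjTranspose_mul, conjTranspose_one] at h'
  rwa [conjTranspose_mul, mul_assoc, mul_sub, hMM, ← conjTranspose_mul,
    show 1 - (A * M)ᴴ = (1 - A * M)ᴴ by rw [conjTranspose_sub, conjTranspose_one]]

theorem conjTranspose_mul_reducedScattering {S : Matrix (p ⊕ q) (p ⊕ q) ℂ}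
    (hS : S ∈ unitaryGroup (p ⊕ q) ℂ) {M : Matrix p p ℂ} (hM : M ∈ unitaryGroup p ℂ)
    (h : IsUnit (1 - S.toBlocks₁₁ * M)) :
    (S.toBlocks₂₁ * (M * (1 - S.toBlocks₁₁ * M)⁻¹))ᴴ *
        (S.toBlocks₂₂ + S.toBlocks₂₁ * (M * (1 - S.toBlocks₁₁ * M)⁻¹) * S.toBlocks₁₂) =
      S.toBlocks₁₂ + S.toBlocks₁₁ * (M * (1 - S.toBlocks₁₁ * M)⁻¹) * S.toBlocks₁₂ := by
  obtain ⟨h₁, h₂⟩ := conjTranspose_toBlocks_mul hS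
  have hN := one_add_mul_inv h
  have hK := conjTranspose_mul_sub hM h
  set A := S.toBlocks₁₁
  set B := S.toBlocks₁₂
  set C := S.toBlocks₂₁
  set D := S.toBlocks₂₂
  set N := (1 - A * M)⁻¹
  have hCD : Cᴴ * D = -(Aᴴ * B) := eq_neg_of_add_eq_zero_right h₂
  have hCC : Cᴴ * C = 1 - Aᴴ * A := eq_sub_of_add_eq' h₁
  calc (C * (M * N))ᴴ * (D + C * (M * N) * B)
      = (M * N)ᴴ * (Cᴴ * D + Cᴴ * C * (M * N) * B) := by
        rw [conjTranspose_mul C]; simp only [Matrix.mul_add, Matrix.mul_assoc]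
    _ = (M * N)ᴴ * ((M * N - Aᴴ * (1 + A * (M * N))) * B) := by
        rw [hCD, hCC]
        simp only [Matrix.sub_mul, Matrix.mul_add, Matrix.add_mul, Matrix.mul_assoc,
          Matrix.mul_one, Matrix.one_mul]
        rw [← Matrix.mul_add]
        abel_nf
    _ = (M * N)ᴴ * (M - Aᴴ) * (N * B) := by
        rw [hN]; simp only [Matrix.sub_mul, Matrix.mul_sub, Matrix.mul_assoc]
    _ = B + A * (M * N) * B := by
        rw [hK, Matrix.one_mul]
        conv_lhs => rw [← hN, Matrix.add_mul, Matrix.one_mul]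

theorem star_mulVec_dotProduct_mulVec {m n : Type*} [Fintype m] [Fintype n]
    (P : Matrix m n ℂ) (x y : n → ℂ) :
    star (P *ᵥ x) ⬝ᵥ P *ᵥ y = star x ⬝ᵥ (Pᴴ * P) *ᵥ y := by
  rw [star_mulVec, ← dotProduct_mulVec, mulVec_mulVec]

theorem dotProduct_reducedCoupling {S : Matrix (p ⊕ q) (p ⊕ q) ℂ}
    (hS : S ∈ unitaryGroup (p ⊕ q) ℂ) {M : Matrix p p ℂ} (hM : M ∈ unitaryGroup p ℂ)
    (h : IsUnit (1 - S.toBlocks₁₁ * M)) (b : p → ℂ) {u : p → ℂ}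
    (hu : u = (M * (1 - S.toBlocks₁₁ * M)⁻¹) *ᵥ b) :
    star (S.toBlocks₂₁ *ᵥ u) ⬝ᵥ S.toBlocks₂₁ *ᵥ u =
      star b ⬝ᵥ b + star b ⬝ᵥ S.toBlocks₁₁ *ᵥ u + star (S.toBlocks₁₁ *ᵥ u) ⬝ᵥ b := by
  have hMM : Mᴴ * M = 1 := mem_unitaryGroup_iff'.mp hM
  have hw : u = M *ᵥ (b + S.toBlocks₁₁ *ᵥ u) := by
    have hN := congrArg (· *ᵥ b) (one_add_mul_inv h)
    simp only [add_mulVec, one_mulVec] at hN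
    rw [← mulVec_mulVec b S.toBlocks₁₁, ← hu] at hN
    rw [hN, mulVec_mulVec, ← hu]
  have hnorm : star u ⬝ᵥ u =
      star (b + S.toBlocks₁₁ *ᵥ u) ⬝ᵥ (b + S.toBlocks₁₁ *ᵥ u) := by
    have := star_mulVec_dotProduct_mulVec M (b + S.toBlocks₁₁ *ᵥ u) (b + S.toBlocks₁₁ *ᵥ u)
    rwa [← hw, hMM, one_mulVec] at this
  have hsplit := congrArg (fun P => star u ⬝ᵥ P *ᵥ u) (conjTranspose_toBlocks_mul hS).1
  simp only [add_mulVec, dotProduct_add, one_mulVec] at hsplit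
  rw [← star_mulVec_dotProduct_mulVec, ← star_mulVec_dotProduct_mulVec] at hsplit
  simp only [star_add, add_dotProduct, dotProduct_add] at hnorm
  linear_combination hsplit + hnorm

theorem star_star_dotProduct {n : Type*} [Fintype n] (x y : n → ℂ) :
    star (star x ⬝ᵥ y) = star y ⬝ᵥ x := by
  rw [← star_dotProduct_star, star_star]

theorem eq_neg_half_sub_I_mul {z w : ℂ} (h : z + star z = -w) :
    z = -(1 / 2 : ℂ) * w - Complex.I * ((-z.im : ℝ) : ℂ) := by
  have hz : z + star z = ((2 * z.re : ℝ) : ℂ) := Complex.add_conj z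
  have := Complex.re_add_im z
  push_cast at *
  linear_combination (1 / 2 : ℂ) * h - (1 / 2 : ℂ) * hz - this

theorem modelMatrix_scalar {S : Matrix (p ⊕ q) (p ⊕ q) ℂ}
    (hS : S ∈ unitaryGroup (p ⊕ q) ℂ) {M : Matrix p p ℂ} (hM : M ∈ unitaryGroup p ℂ)
    (h : IsUnit (1 - S.toBlocks₁₁ * M)) (b : p → ℂ) (c : q → ℂ) (θ : ℝ) {u : p → ℂ}
    (hu : u = (M * (1 - S.toBlocks₁₁ * M)⁻¹) *ᵥ b) :
    ∃ θfb : ℝ,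
      -(1 / 2 : ℂ) * (star b ⬝ᵥ b + star c ⬝ᵥ c) - Complex.I * θ -
          (star b ⬝ᵥ S.toBlocks₁₁ *ᵥ u + star c ⬝ᵥ S.toBlocks₂₁ *ᵥ u) =
        -(1 / 2 : ℂ) * (star (c + S.toBlocks₂₁ *ᵥ u) ⬝ᵥ (c + S.toBlocks₂₁ *ᵥ u)) -
          Complex.I * θfb := by
  refine ⟨_, eq_neg_half_sub_I_mul ?_⟩
  have hC := dotProduct_reducedCoupling hS hM h b hu
  simp only [star_sub, star_add, star_mul', star_neg, star_div₀, star_one, star_ofNat,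
    star_star_dotProduct, ← starRingEnd_apply Complex.I, Complex.conj_I,
    ← starRingEnd_apply (θ : ℂ), Complex.conj_ofReal, add_dotProduct, dotProduct_add]
  linear_combination hC

end FeedbackReduction

/-- The model matrix form is preserved under feedback reduction: shorting the `n₁`
internal modes of `V(S, β, θ)` through a unitary `M` yields `V(S_fb, β_fb, θ_fb)`
for some real phase `θ_fb`, where `S_fb = S₂₂ + S₂₁ M (1 − S₁₁ M)⁻¹ S₁₂` and
`β_fb = β₂ + S₂₁ M (1 − S₁₁ M)⁻¹ β₁`. -/
theorem stmt_18 (n₁ n₂ : ℕ)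
    (S : Matrix (Fin n₁ ⊕ Fin n₂) (Fin n₁ ⊕ Fin n₂) ℂ)
    (hS : S ∈ Matrix.unitaryGroup (Fin n₁ ⊕ Fin n₂) ℂ)
    (β : Fin n₁ ⊕ Fin n₂ → ℂ) (θ : ℝ)
    (M : Matrix (Fin n₁) (Fin n₁) ℂ)
    (hM : M ∈ Matrix.unitaryGroup (Fin n₁) ℂ)
    (hinv : IsUnit (1 - S.toBlocks₁₁ * M)) :
    ∃ θfb : ℝ,
      (modelMatrix S β θ).submatrix (extIdx n₁ n₂) (extIdx n₁ n₂)
        + (modelMatrix S β θ).submatrix (extIdx n₁ n₂) (intIdx n₁ n₂) * M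
            * (1 - (modelMatrix S β θ).submatrix (intIdx n₁ n₂) (intIdx n₁ n₂) * M)⁻¹
            * (modelMatrix S β θ).submatrix (intIdx n₁ n₂) (extIdx n₁ n₂)
      = modelMatrix
          (S.toBlocks₂₂ + S.toBlocks₂₁ * M * (1 - S.toBlocks₁₁ * M)⁻¹ * S.toBlocks₁₂)
          ((β ∘ Sum.inr) + (S.toBlocks₂₁ * M * (1 - S.toBlocks₁₁ * M)⁻¹) *ᵥ (β ∘ Sum.inl))
          θfb := by
  obtain ⟨θfb, hθ⟩ := FeedbackReduction.modelMatrix_scalar hS hM hinv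
    (β ∘ Sum.inl) (β ∘ Sum.inr) θ rfl
  have hS' := FeedbackReduction.conjTranspose_mul_reducedScattering hS hM hinv
  refine ⟨θfb, ?_⟩
  have hII : (modelMatrix S β θ).submatrix (intIdx n₁ n₂) (intIdx n₁ n₂) = S.toBlocks₁₁ := rfl
  rw [hII, Matrix.mul_assoc _ M, Matrix.mul_assoc S.toBlocks₂₁ M]
  set K := M * (1 - S.toBlocks₁₁ * M)⁻¹
  have hentry (X : Matrix (Unit ⊕ Fin n₂) (Fin n₁) ℂ) (Y : Matrix (Fin n₁) (Unit ⊕ Fin n₂) ℂ)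
      (i j) : (X * K * Y) i j = X i ⬝ᵥ K *ᵥ Y.col j := by
    rw [Matrix.mul_assoc]; rfl
  have hrow : (modelMatrix S β θ).submatrix (extIdx n₁ n₂) (intIdx n₁ n₂) (Sum.inl ()) =
      -(star (β ∘ Sum.inl) ᵥ* S.toBlocks₁₁ + star (β ∘ Sum.inr) ᵥ* S.toBlocks₂₁) := by
    ext k
    exact congrArg Neg.neg (Fintype.sum_sum_type fun i => star β i * S i (Sum.inl k))
  have hrow' : (fun j => (modelMatrix S β θ).submatrix (extIdx n₁ n₂) (extIdx n₁ n₂)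
        (Sum.inl ()) (Sum.inr j)) =
      -(star (β ∘ Sum.inl) ᵥ* S.toBlocks₁₂ + star (β ∘ Sum.inr) ᵥ* S.toBlocks₂₂) := by
    ext k
    exact congrArg Neg.neg (Fintype.sum_sum_type fun i => star β i * S i (Sum.inr k))
  have hnorm : star β ⬝ᵥ β = star (β ∘ Sum.inl) ⬝ᵥ (β ∘ Sum.inl) +
      star (β ∘ Sum.inr) ⬝ᵥ (β ∘ Sum.inr) := Fintype.sum_sum_type _
  ext (i | i) (j | j)
  · rw [Matrix.add_apply, hentry, hrow]
    change -(1 / 2 : ℂ) * (star β ⬝ᵥ β) - Complex.I * θ +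
      -(star (β ∘ Sum.inl) ᵥ* S.toBlocks₁₁ + star (β ∘ Sum.inr) ᵥ* S.toBlocks₂₁) ⬝ᵥ
        K *ᵥ (β ∘ Sum.inl) = -(1 / 2 : ℂ) * (star _ ⬝ᵥ _) - Complex.I * θfb
    rw [neg_dotProduct, add_dotProduct, ← dotProduct_mulVec, ← dotProduct_mulVec, hnorm,
      ← sub_eq_add_neg, hθ, mulVec_mulVec]
  · rw [Matrix.add_apply, hentry, hrow, congrFun hrow' j]
    change (-(star (β ∘ Sum.inl) ᵥ* S.toBlocks₁₂ + star (β ∘ Sum.inr) ᵥ* S.toBlocks₂₂)) j +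
      -(star (β ∘ Sum.inl) ᵥ* S.toBlocks₁₁ + star (β ∘ Sum.inr) ᵥ* S.toBlocks₂₁) ⬝ᵥ
        K *ᵥ S.toBlocks₁₂.col j = -(star _ ᵥ* _) j
    rw [star_add, add_vecMul, star_mulVec, vecMul_vecMul, hS', dotProduct_mulVec]
    change _ + (-(star (β ∘ Sum.inl) ᵥ* S.toBlocks₁₁ + star (β ∘ Sum.inr) ᵥ* S.toBlocks₂₁) ᵥ* K
      ᵥ* S.toBlocks₁₂) j = _
    simp only [neg_vecMul, add_vecMul, vecMul_add, vecMul_vecMul, Pi.neg_apply, Pi.add_apply]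
    ring
  · rw [Matrix.add_apply, hentry]
    change β (Sum.inr i) + S.toBlocks₂₁ i ⬝ᵥ K *ᵥ (β ∘ Sum.inl) =
      β (Sum.inr i) + ((S.toBlocks₂₁ * K) *ᵥ (β ∘ Sum.inl)) i
    rw [← mulVec_mulVec _ S.toBlocks₂₁]
    rfl
  · rw [Matrix.add_apply, hentry]
    change S.toBlocks₂₂ i j + S.toBlocks₂₁ i ⬝ᵥ K *ᵥ S.toBlocks₁₂.col j = _ + _
    rw [Matrix.mul_assoc]
    rfl
end
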